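/- If f : ℝ × ℝ → ℝ is a C² solution of the Born-Infeld equation on ℝ², then for every real ε the Lorentz-boosted function u(x,t) = f(x·cosh ε − t·sinh ε, −x·sinh ε + t·cosh ε) is also a C² solution of the Born-Infeld equation on ℝ². (This expresses the symmetry generated by v₄ = t∂_x + x∂_t.) -/

import Mathlib

/-- Partial derivative with respect to the first variable `x`. -/
noncomputable def px (u : ℝ × ℝ → ℝ) (p : ℝ × ℝ) : ℝ := fderiv ℝ u p (1, 0)

/-- Partial derivative with respect to the second variable `t`. -/
noncomputable def pt (u : ℝ × ℝ → ℝ) (p : ℝ × ℝ) : ℝ := fderiv ℝ u p (0, 1)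

/-- `u` is a (C²) solution of the Born-Infeld equation
`(1 - u_t²)·u_xx + 2·u_x·u_t·u_xt - (1 + u_x²)·u_tt = 0` on the set `Ω`:
`u` is C² on a neighborhood of `Ω` and the equation holds at every point of `Ω`. -/
def IsBISolution (u : ℝ × ℝ → ℝ) (Ω : Set (ℝ × ℝ)) : Prop :=
  (∃ V : Set (ℝ × ℝ), IsOpen V ∧ Ω ⊆ V ∧ ContDiffOn ℝ 2 u V) ∧
  ∀ p ∈ Ω,
    (1 - pt u p ^ 2) * px (px u) p + 2 * px u p * pt u p * px (pt u) p
      - (1 + px u p ^ 2) * pt (pt u) p = 0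

lemma boost_hasFDerivAt (c s : ℝ) (p : ℝ × ℝ) :
    HasFDerivAt (fun p : ℝ × ℝ => (p.1 * c - p.2 * s, -p.1 * s + p.2 * c))
      (((c • ContinuousLinearMap.fst ℝ ℝ ℝ - s • ContinuousLinearMap.snd ℝ ℝ ℝ).prod
        (-(s • ContinuousLinearMap.fst ℝ ℝ ℝ) + c • ContinuousLinearMap.snd ℝ ℝ ℝ))) p := by
  have h := ((c • ContinuousLinearMap.fst ℝ ℝ ℝ - s • ContinuousLinearMap.snd ℝ ℝ ℝ).prod
        (-(s • ContinuousLinearMap.fst ℝ ℝ ℝ) + c • ContinuousLinearMap.snd ℝ ℝ ℝ)).hasFDerivAt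
          (x := p)
  convert h using 1
  funext q
  simp [mul_comm]

lemma fderiv_pair (g : ℝ × ℝ → ℝ) (q : ℝ × ℝ) (a b : ℝ) :
    fderiv ℝ g q (a, b) = a * px g q + b * pt g q := by
  have : ((a, b) : ℝ × ℝ) = a • ((1, 0) : ℝ × ℝ) + b • ((0, 1) : ℝ × ℝ) := by simp
  rw [this, map_add, map_smul, map_smul]
  simp [px, pt]

lemma px_boost (g : ℝ × ℝ → ℝ) (hg : Differentiable ℝ g) (c s : ℝ) :
    px (fun p : ℝ × ℝ => g (p.1 * c - p.2 * s, -p.1 * s + p.2 * c)) =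
      fun p => c * px g (p.1 * c - p.2 * s, -p.1 * s + p.2 * c)
        + (-s) * pt g (p.1 * c - p.2 * s, -p.1 * s + p.2 * c) := by
  funext p
  have h := ((hg _).hasFDerivAt.comp p (boost_hasFDerivAt c s p)).fderiv
  rw [← fderiv_pair]
  change fderiv ℝ (g ∘ fun p : ℝ × ℝ => (p.1 * c - p.2 * s, -p.1 * s + p.2 * c)) p (1, 0) = _
  rw [h]
  simp

lemma pt_boost (g : ℝ × ℝ → ℝ) (hg : Differentiable ℝ g) (c s : ℝ) :
    pt (fun p : ℝ × ℝ => g (p.1 * c - p.2 * s, -p.1 * s + p.2 * c)) =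
      fun p => (-s) * px g (p.1 * c - p.2 * s, -p.1 * s + p.2 * c)
        + c * pt g (p.1 * c - p.2 * s, -p.1 * s + p.2 * c) := by
  funext p
  have h := ((hg _).hasFDerivAt.comp p (boost_hasFDerivAt c s p)).fderiv
  rw [← fderiv_pair]
  change fderiv ℝ (g ∘ fun p : ℝ × ℝ => (p.1 * c - p.2 * s, -p.1 * s + p.2 * c)) p (0, 1) = _
  rw [h]
  simp

lemma px_lin (g h : ℝ × ℝ → ℝ) (hg : Differentiable ℝ g) (hh : Differentiable ℝ h) (a b : ℝ)
    (p : ℝ × ℝ) : px (fun q => a * g q + b * h q) p = a * px g p + b * px h p := by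
  have := (((hg p).hasFDerivAt.const_mul a).add ((hh p).hasFDerivAt.const_mul b)).fderiv
  change fderiv ℝ ((fun q => a * g q) + fun q => b * h q) p (1, 0) = _
  rw [this]
  simp [px]

lemma pt_lin (g h : ℝ × ℝ → ℝ) (hg : Differentiable ℝ g) (hh : Differentiable ℝ h) (a b : ℝ)
    (p : ℝ × ℝ) : pt (fun q => a * g q + b * h q) p = a * pt g p + b * pt h p := by
  have := (((hg p).hasFDerivAt.const_mul a).add ((hh p).hasFDerivAt.const_mul b)).fderiv
  change fderiv ℝ ((fun q => a * g q) + fun q => b * h q) p (0, 1) = _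
  rw [this]
  simp [pt]

lemma px_pt_comm (f : ℝ × ℝ → ℝ) (hf : ContDiff ℝ 2 f) (p : ℝ × ℝ) :
    px (pt f) p = pt (px f) p := by
  have hd : Differentiable ℝ (fderiv ℝ f) :=
    (hf.fderiv_right (m := 1) (by norm_num)).differentiable (by norm_num)
  have key (v w : ℝ × ℝ) :
      fderiv ℝ (fun q => fderiv ℝ f q v) p w = fderiv ℝ (fderiv ℝ f) p w v := by
    rw [fderiv_clm_apply (hd p) (differentiableAt_const v)]
    simp
  have hs : IsSymmSndFDerivAt ℝ f p := hf.contDiffAt.isSymmSndFDerivAt (by simp)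
  change fderiv ℝ (fun q => fderiv ℝ f q (0, 1)) p (1, 0)
    = fderiv ℝ (fun q => fderiv ℝ f q (1, 0)) p (0, 1)
  rw [key, key]
  exact hs _ _

/-- Lorentz boost symmetry `v₄ = t∂ₓ + x∂_t` of the Born-Infeld equation. -/
theorem bornInfeld_boost_symmetry
    (f : ℝ × ℝ → ℝ) (hf : ContDiff ℝ 2 f)
    (hsol : IsBISolution f Set.univ) (ε : ℝ) :
    IsBISolution
      (fun p : ℝ × ℝ =>
        f (p.1 * Real.cosh ε - p.2 * Real.sinh ε,
           -p.1 * Real.sinh ε + p.2 * Real.cosh ε)) Set.univ := by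
  have hcs : Real.cosh ε ^ 2 - Real.sinh ε ^ 2 = 1 := Real.cosh_sq_sub_sinh_sq ε
  generalize Real.cosh ε = c at *
  generalize Real.sinh ε = s at *
  have hL : ContDiff ℝ 2 (fun p : ℝ × ℝ => (p.1 * c - p.2 * s, -p.1 * s + p.2 * c)) := by
    fun_prop
  refine ⟨⟨Set.univ, isOpen_univ, subset_rfl, (hf.comp hL).contDiffOn⟩, fun p _ => ?_⟩
  have hLd := hL.differentiable (by norm_num)
  have hfd : Differentiable ℝ f := hf.differentiable (by norm_num)
  have hd : Differentiable ℝ (fderiv ℝ f) :=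
    (hf.fderiv_right (m := 1) (by norm_num)).differentiable (by norm_num)
  have hx : Differentiable ℝ (px f) := hd.clm_apply (differentiable_const _)
  have ht : Differentiable ℝ (pt f) := hd.clm_apply (differentiable_const _)
  have hxL : Differentiable ℝ
      (fun p : ℝ × ℝ => px f (p.1 * c - p.2 * s, -p.1 * s + p.2 * c)) := hx.comp hLd
  have htL : Differentiable ℝ
      (fun p : ℝ × ℝ => pt f (p.1 * c - p.2 * s, -p.1 * s + p.2 * c)) := ht.comp hLd
  have e := hsol.2 (p.1 * c - p.2 * s, -p.1 * s + p.2 * c) (Set.mem_univ _)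
  have hsym := px_pt_comm f hf (p.1 * c - p.2 * s, -p.1 * s + p.2 * c)
  rw [px_boost f hfd, pt_boost f hfd, px_lin _ _ hxL htL,
    px_lin _ _ hxL htL, pt_lin _ _ hxL htL,
    px_boost _ hx, px_boost _ ht, pt_boost _ hx, pt_boost _ ht]
  simp only [← hsym]
  generalize px (px f) _ = A at *
  generalize px (pt f) _ = B at *
  generalize pt (pt f) _ = C at *
  generalize px f _ = X at *
  generalize pt f _ = T at *
  clear hsym
  linear_combination (c ^ 2 - s ^ 2) ^ 2 * e - (c ^ 2 - s ^ 2) * (A - C) * hcs
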